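/- Let 1 ≤ p ≤ 2 and q ≥ 1. For every positive semidefinite Y ∈ M_n ⊗ M_m, ‖Y‖_{NC:p,q} ≤ Ψ_{p,q}(Y). -/

import Mathlib

open scoped Kronecker
open Matrix
open scoped ENNReal NNReal ComplexOrder

noncomputable section

open scoped Classical in
/-- The Schatten `p`-norm of a complex square matrix, `p ∈ [1,∞]` (as an `ℝ≥0∞`).
For finite `p` it equals `(Tr |A|^p)^{1/p}`, computed via the eigenvalues of `Aᴴ * A`;
for `p = ∞` it is the operator norm (largest singular value). -/
noncomputable def schattenNorm {k : Type*} [Fintype k] [DecidableEq k] (p : ℝ≥0∞)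
    (A : Matrix k k ℂ) : ℝ :=
  if p = ⊤ then
    ⨆ i, Real.sqrt ((Matrix.posSemidef_conjTranspose_mul_self A).isHermitian.eigenvalues i)
  else
    (∑ i, (Matrix.posSemidef_conjTranspose_mul_self A).isHermitian.eigenvalues i
        ^ (p.toReal / 2)) ^ (1 / p.toReal)

/-- `r` defined by `1/r = max{1/p, 1/q} - min{1/p, 1/q}` (so `r = ∞` when `p = q`). -/
noncomputable def ncR (p q : ℝ≥0∞) : ℝ≥0∞ := (max p⁻¹ q⁻¹ - min p⁻¹ q⁻¹)⁻¹

/-- The non-commutative `L^q(L^p)` norm (supremum form, used when `p ≤ q`):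
`sup_{A,B} ‖(A ⊗ I) Y (B ⊗ I)‖_p / (‖A‖_{2r} ‖B‖_{2r})`. -/
noncomputable def ncNormSup {k l : Type*} [Fintype k] [DecidableEq k] [Fintype l] [DecidableEq l]
    (p q : ℝ≥0∞) (Y : Matrix (k × l) (k × l) ℂ) : ℝ :=
  ⨆ A : Matrix k k ℂ, ⨆ B : Matrix k k ℂ,
    schattenNorm p ((A ⊗ₖ (1 : Matrix l l ℂ)) * Y * (B ⊗ₖ (1 : Matrix l l ℂ))) /
      (schattenNorm (2 * ncR p q) A * schattenNorm (2 * ncR p q) B)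

/-- The non-commutative `L^q(L^p)` norm (infimum form, used when `q ≤ p`):
`inf { ∑ᵢ ‖Aᵢ‖_{2r} ‖Bᵢ‖_{2r} ‖Zᵢ‖_p : Y = ∑ᵢ (Aᵢ ⊗ I) Zᵢ (Bᵢ ⊗ I) }`. -/
noncomputable def ncNormInf {k l : Type*} [Fintype k] [DecidableEq k] [Fintype l] [DecidableEq l]
    (p q : ℝ≥0∞) (Y : Matrix (k × l) (k × l) ℂ) : ℝ :=
  sInf { s : ℝ | ∃ (N : ℕ) (A B : Fin N → Matrix k k ℂ)
      (Z : Fin N → Matrix (k × l) (k × l) ℂ),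
    Y = ∑ i, (A i ⊗ₖ (1 : Matrix l l ℂ)) * Z i * (B i ⊗ₖ (1 : Matrix l l ℂ)) ∧
    s = ∑ i, schattenNorm (2 * ncR p q) (A i) * schattenNorm (2 * ncR p q) (B i) *
          schattenNorm p (Z i) }

open scoped Classical in
/-- The non-commutative `L^q(L^p)` norm `‖·‖_{NC:p,q}`. -/
noncomputable def ncNorm {k l : Type*} [Fintype k] [DecidableEq k] [Fintype l] [DecidableEq l]
    (p q : ℝ≥0∞) (Y : Matrix (k × l) (k × l) ℂ) : ℝ :=
  if p ≤ q then ncNormSup p q Y else ncNormInf p q Y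

open scoped Classical in
/-- Real power of a Hermitian matrix via the spectral decomposition (junk value `0` on
non-Hermitian matrices). -/
noncomputable def mrpow {k : Type*} [Fintype k] [DecidableEq k] (A : Matrix k k ℂ) (e : ℝ) :
    Matrix k k ℂ :=
  if hA : A.IsHermitian then
    (hA.eigenvectorUnitary : Matrix k k ℂ) *
      Matrix.diagonal (fun i => ((hA.eigenvalues i ^ e : ℝ) : ℂ)) *
      ((hA.eigenvectorUnitary : Matrix k k ℂ))ᴴ
  else 0

/-- Partial trace over the second (inside) factor. -/
noncomputable def ptrace2 {k l : Type*} [Fintype l]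
    (Y : Matrix (k × l) (k × l) ℂ) : Matrix k k ℂ :=
  fun i i' => ∑ j : l, Y (i, j) (i', j)

/-- The Carlen–Lieb quantity `Ψ_{p,q}(Y) = (Tr₁ (Tr₂ Y^p)^{q/p})^{1/q}`. -/
noncomputable def Psi {k l : Type*} [Fintype k] [DecidableEq k] [Fintype l] [DecidableEq l]
    (p q : ℝ) (Y : Matrix (k × l) (k × l) ℂ) : ℝ :=
  (Matrix.trace (mrpow (ptrace2 (mrpow Y p)) (q / p))).re ^ (1 / q)

/-- The quantity `|||X|||_{p,q} = inf {Ψ_{p,q}(A) + Ψ_{p,q}(B) : X + A = B, A ≥ 0, B ≥ 0}`,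
for `X` on the space `M_k ⊗ (M_l ⊗ M_2)`. -/
noncomputable def tripleNorm {k l : Type*} [Fintype k] [DecidableEq k] [Fintype l] [DecidableEq l]
    (p q : ℝ) (X : Matrix (k × (l × Fin 2)) (k × (l × Fin 2)) ℂ) : ℝ :=
  sInf { s : ℝ | ∃ A B : Matrix (k × (l × Fin 2)) (k × (l × Fin 2)) ℂ,
    A.PosSemidef ∧ B.PosSemidef ∧ X + A = B ∧ s = Psi p q A + Psi p q B }

/-- The block matrix `[[0, Y],[Yᴴ, 0]]`, viewed in `M_k ⊗ (M_l ⊗ M_2)`. -/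
noncomputable def clBlock {k l : Type*} (Y : Matrix (k × l) (k × l) ℂ) :
    Matrix (k × (l × Fin 2)) (k × (l × Fin 2)) ℂ :=
  fun x y =>
    if x.2.2 = 0 ∧ y.2.2 = 1 then Y (x.1, x.2.1) (y.1, y.2.1)
    else if x.2.2 = 1 ∧ y.2.2 = 0 then star (Y (y.1, y.2.1) (x.1, x.2.1))
    else 0

/-- The block-diagonal matrix `diag(P, Q) = [[P, 0],[0, Q]]`, viewed in `M_k ⊗ (M_l ⊗ M_2)`. -/
noncomputable def blockDiag2 {k l : Type*} (P Q : Matrix (k × l) (k × l) ℂ) :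
    Matrix (k × (l × Fin 2)) (k × (l × Fin 2)) ℂ :=
  fun x y =>
    if x.2.2 = 0 ∧ y.2.2 = 0 then P (x.1, x.2.1) (y.1, y.2.1)
    else if x.2.2 = 1 ∧ y.2.2 = 1 then Q (x.1, x.2.1) (y.1, y.2.1)
    else 0

/-- The Carlen–Lieb norm `‖Y‖_{CL} = (1/2) ||| [[0,Y],[Yᴴ,0]] |||_{p,q}`. -/
noncomputable def clNorm {k l : Type*} [Fintype k] [DecidableEq k] [Fintype l] [DecidableEq l]
    (p q : ℝ) (Y : Matrix (k × l) (k × l) ℂ) : ℝ :=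
  (1 / 2) * tripleNorm p q (clBlock Y)

end

section ThreeLines

open scoped Matrix.Norms.L2Operator

/-- The analytic power `x ^ w` of a nonnegative real number, extended by `0` at `x = 0`. -/
noncomputable def analyticPow (x : ℝ) (w : ℂ) : ℂ :=
  if x = 0 then 0 else Complex.exp (w * Real.log x)

lemma analyticPow_zero_left (w : ℂ) : analyticPow 0 w = 0 := by simp [analyticPow]

lemma norm_analyticPow_of_pos {x : ℝ} (hx : 0 < x) (w : ℂ) :
    ‖analyticPow x w‖ = x ^ w.re := by
  rw [analyticPow, if_neg hx.ne', Complex.norm_exp, Real.rpow_def_of_pos hx]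
  congr 1
  rw [Complex.re_mul_ofReal, mul_comm]

lemma norm_analyticPow_le {x : ℝ} (hx : 0 ≤ x) (w : ℂ) : ‖analyticPow x w‖ ≤ x ^ w.re := by
  rcases hx.eq_or_lt with rfl | h
  · rw [analyticPow_zero_left, norm_zero]
    positivity
  · exact (norm_analyticPow_of_pos h w).le

lemma analyticPow_ofReal {x : ℝ} (hx : 0 ≤ x) {t : ℝ} (ht : t ≠ 0) :
    analyticPow x t = (x ^ t : ℝ) := by
  rcases hx.eq_or_lt with rfl | h
  · rw [analyticPow_zero_left, Real.zero_rpow ht, Complex.ofReal_zero]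
  · rw [analyticPow, if_neg h.ne', Real.rpow_def_of_pos h]
    push_cast
    rw [mul_comm]

lemma analyticPow_mul (x : ℝ) (v w : ℂ) :
    analyticPow x v * analyticPow x w = analyticPow x (v + w) := by
  unfold analyticPow
  split_ifs
  · simp
  · rw [← Complex.exp_add, add_mul]

/-- Entire functions that are bounded on the closed strip `0 ≤ re z ≤ 1`. -/
def EntireBddOnStrip (f : ℂ → ℂ) : Prop :=
  Differentiable ℂ f ∧ ∃ C, ∀ z ∈ Complex.HadamardThreeLines.verticalClosedStrip 0 1, ‖f z‖ ≤ C

namespace EntireBddOnStrip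

lemma const (c : ℂ) : EntireBddOnStrip fun _ => c :=
  ⟨differentiable_const c, ‖c‖, fun _ _ => le_rfl⟩

lemma mul {f g : ℂ → ℂ} (hf : EntireBddOnStrip f) (hg : EntireBddOnStrip g) :
    EntireBddOnStrip fun z => f z * g z := by
  obtain ⟨hf, C, hC⟩ := hf
  obtain ⟨hg, D, hD⟩ := hg
  refine ⟨hf.mul hg, C * D, fun z hz => ?_⟩
  rw [norm_mul]
  exact mul_le_mul (hC z hz) (hD z hz) (norm_nonneg _) ((norm_nonneg _).trans (hC z hz))

lemma sum {ι : Type*} (s : Finset ι) {f : ι → ℂ → ℂ} (hf : ∀ i, EntireBddOnStrip (f i)) :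
    EntireBddOnStrip fun z => ∑ i ∈ s, f i z := by
  choose hd C hC using hf
  refine ⟨Differentiable.fun_sum fun i _ => hd i, ∑ i ∈ s, C i, fun z hz => ?_⟩
  exact (norm_sum_le _ _).trans (Finset.sum_le_sum fun i _ => hC i z hz)

lemma analyticPow_affine (x α β : ℝ) :
    EntireBddOnStrip fun z => analyticPow x (α + β * z) := by
  unfold analyticPow
  split_ifs with hx
  · exact const 0
  · refine ⟨by fun_prop, Real.exp (|α * Real.log x| + |β * Real.log x|), fun z hz => ?_⟩
    have hz : 0 ≤ z.re ∧ z.re ≤ 1 := hz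
    rw [Complex.norm_exp, Complex.re_mul_ofReal]
    apply Real.exp_le_exp.2
    have h1 : ((α : ℂ) + β * z).re = α + β * z.re := by simp
    rw [h1, add_mul]
    refine add_le_add (le_abs_self _) ?_
    calc β * z.re * Real.log x = z.re * (β * Real.log x) := by ring
      _ ≤ z.re * |β * Real.log x| := mul_le_mul_of_nonneg_left (le_abs_self _) hz.1
      _ ≤ 1 * |β * Real.log x| := mul_le_mul_of_nonneg_right hz.2 (abs_nonneg _)
      _ = _ := one_mul _

lemma matrix_mul {ι : Type*} [Fintype ι] {M N : ℂ → Matrix ι ι ℂ}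
    (hM : ∀ i j, EntireBddOnStrip fun z => M z i j)
    (hN : ∀ i j, EntireBddOnStrip fun z => N z i j) (i j : ι) :
    EntireBddOnStrip fun z => (M z * N z) i j := by
  simp only [Matrix.mul_apply]
  exact sum _ fun k => (hM i k).mul (hN k j)

lemma matrix_diagonal {ι : Type*} [DecidableEq ι] {d : ℂ → ι → ℂ}
    (hd : ∀ i, EntireBddOnStrip fun z => d z i) (i j : ι) :
    EntireBddOnStrip fun z => Matrix.diagonal (d z) i j := by
  simp only [Matrix.diagonal_apply]
  split_ifs
  · exact hd i
  · exact const 0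

end EntireBddOnStrip

/-- The squared Frobenius norm. -/
noncomputable def frobeniusSq {ι : Type*} [Fintype ι] (M : Matrix ι ι ℂ) : ℝ :=
  ∑ i, ∑ j, ‖M i j‖ ^ 2

variable {ι : Type*} [Fintype ι]

lemma frobeniusSq_nonneg (M : Matrix ι ι ℂ) : 0 ≤ frobeniusSq M := by
  unfold frobeniusSq
  positivity

lemma frobeniusSq_conjTranspose (M : Matrix ι ι ℂ) : frobeniusSq Mᴴ = frobeniusSq M := by
  unfold frobeniusSq
  rw [Finset.sum_comm]
  simp

lemma frobeniusSq_eq_trace (M : Matrix ι ι ℂ) : (frobeniusSq M : ℂ) = (M * Mᴴ).trace := by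
  simp [frobeniusSq, Matrix.trace, Matrix.mul_apply, Complex.mul_conj, Complex.normSq_eq_norm_sq]

lemma norm_trace_mul_le (M N : Matrix ι ι ℂ) :
    ‖(M * N).trace‖ ≤ √(frobeniusSq M * frobeniusSq N) := by
  apply Real.le_sqrt_of_sq_le
  have h1 : ‖(M * N).trace‖ ≤ ∑ x : ι × ι, ‖M x.1 x.2‖ * ‖N x.2 x.1‖ := by
    rw [Fintype.sum_prod_type]
    simp only [Matrix.trace, Matrix.diag_apply, Matrix.mul_apply]
    refine (norm_sum_le _ _).trans (Finset.sum_le_sum fun i _ => (norm_sum_le _ _).trans ?_)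
    simp
  refine (pow_le_pow_left₀ (norm_nonneg _) h1 2).trans
    ((Finset.sum_mul_sq_le_sq_mul_sq _ _ _).trans_eq ?_)
  rw [← frobeniusSq_conjTranspose N]
  simp [frobeniusSq, Fintype.sum_prod_type]

variable [DecidableEq ι]

lemma frobeniusSq_mul_le (P L : Matrix ι ι ℂ) (hP : ‖P‖ ≤ 1) :
    frobeniusSq (P * L) ≤ frobeniusSq L := by
  unfold frobeniusSq
  rw [Finset.sum_comm, Finset.sum_comm (f := fun i j => ‖L i j‖ ^ 2)]
  refine Finset.sum_le_sum fun j _ => ?_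
  have h := Matrix.l2_opNorm_mulVec P (WithLp.toLp 2 fun i => L i j)
  have h2 := h.trans (mul_le_of_le_one_left (norm_nonneg _) hP)
  have h3 := pow_le_pow_left₀ (norm_nonneg _) h2 2
  rw [EuclideanSpace.norm_sq_eq, EuclideanSpace.norm_sq_eq] at h3
  exact h3

lemma frobeniusSq_mul_le_right (L P : Matrix ι ι ℂ) (hP : ‖P‖ ≤ 1) :
    frobeniusSq (L * P) ≤ frobeniusSq L := by
  rw [← frobeniusSq_conjTranspose, ← frobeniusSq_conjTranspose L, Matrix.conjTranspose_mul]
  exact frobeniusSq_mul_le _ _ ((Matrix.l2_opNorm_conjTranspose P).trans_le hP)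

lemma frobeniusSq_diagonal (d : ι → ℂ) :
    frobeniusSq (Matrix.diagonal d) = ∑ i, ‖d i‖ ^ 2 := by
  unfold frobeniusSq
  refine Finset.sum_congr rfl fun i _ => ?_
  rw [Finset.sum_eq_single i] <;> simp +contextual [eq_comm]

lemma frobeniusSq_diagonal_mul_mul_diagonal_le (V : Matrix ι ι ℂ) {c d : ι → ℂ} {a b : ι → ℝ}
    (hc : ∀ i, ‖c i‖ ^ 2 ≤ a i) (hd : ∀ i, ‖d i‖ ^ 2 ≤ b i) :
    frobeniusSq (Matrix.diagonal c * V * Matrix.diagonal d) ≤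
      ∑ i, ∑ j, a i * ‖V i j‖ ^ 2 * b j := by
  unfold frobeniusSq
  refine Finset.sum_le_sum fun i _ => Finset.sum_le_sum fun j _ => ?_
  rw [Matrix.mul_diagonal, Matrix.diagonal_mul, norm_mul, norm_mul, mul_pow, mul_pow]
  have := (sq_nonneg ‖c i‖).trans (hc i)
  exact mul_le_mul (mul_le_mul_of_nonneg_right (hc i) (sq_nonneg _)) (hd j) (sq_nonneg _)
    (by positivity)

lemma norm_diagonal_le_one {d : ι → ℂ} (hd : ∀ i, ‖d i‖ ≤ 1) :
    ‖(Matrix.diagonal d : Matrix ι ι ℂ)‖ ≤ 1 := by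
  rw [Matrix.l2_opNorm_diagonal]
  exact (pi_norm_le_iff_of_nonneg zero_le_one).2 hd

lemma norm_mul_le_one {P Q : Matrix ι ι ℂ} (hP : ‖P‖ ≤ 1) (hQ : ‖Q‖ ≤ 1) : ‖P * Q‖ ≤ 1 :=
  (norm_mul_le P Q).trans (mul_le_one₀ hP (norm_nonneg _) hQ)

lemma norm_le_one_of_conjTranspose_mul_self {P : Matrix ι ι ℂ} {d : ι → ℂ}
    (h : Pᴴ * P = Matrix.diagonal d) (hd : ∀ i, ‖d i‖ ≤ 1) : ‖P‖ ≤ 1 := by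
  have h1 := Matrix.l2_opNorm_conjTranspose_mul_self P
  rw [h] at h1
  have h2 := norm_diagonal_le_one hd
  nlinarith [norm_nonneg P]

lemma norm_le_one_of_mem_unitaryGroup {U : Matrix ι ι ℂ} (hU : U ∈ Matrix.unitaryGroup ι ℂ) :
    ‖U‖ ≤ 1 := by
  refine norm_le_one_of_conjTranspose_mul_self (d := fun _ => 1) ?_ (by simp)
  rw [Matrix.diagonal_one]
  exact Matrix.mem_unitaryGroup_iff'.1 hU

lemma diagonal_mul_conjTranspose_mul_self {K : Matrix ι ι ℂ} {h : ι → ℝ}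
    (hK : Kᴴ * K = Matrix.diagonal fun i => (h i : ℂ)) (d : ι → ℂ) :
    Matrix.diagonal d * Kᴴ * (Matrix.diagonal d * Kᴴ)ᴴ =
      Matrix.diagonal fun i => ((‖d i‖ ^ 2 * h i : ℝ) : ℂ) := by
  rw [Matrix.conjTranspose_mul, Matrix.conjTranspose_conjTranspose,
    Matrix.diagonal_conjTranspose, Matrix.mul_assoc, ← Matrix.mul_assoc Kᴴ, hK,
    Matrix.diagonal_mul_diagonal, Matrix.diagonal_mul_diagonal]
  congr 1
  funext i
  rw [mul_left_comm, Pi.star_apply, Complex.star_def, Complex.mul_conj,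
    Complex.normSq_eq_norm_sq]
  push_cast
  ring

/-- Three-lines interpolation bound for the Schatten norm of a product: if `h` lists the
eigenvalues of `Xᴴ * X`, where `X = D(a) V₁ D(y) V₂ D(b)` with contractions `V₁, V₂`, then
`∑ h ^ (p / 2)` is at most the geometric mean of `‖D(a)^p V₁ D(y)^(p/2)‖₂²` and
`‖D(y)^(p/2) V₂ D(b)^p‖₂²`. -/
theorem sum_rpow_half_le_sqrt {p : ℝ} (hp : 1 ≤ p) {V₁ V₂ E X : Matrix ι ι ℂ} {a y b h : ι → ℝ}
    (ha : ∀ i, 0 ≤ a i) (hy : ∀ i, 0 ≤ y i) (hb : ∀ i, 0 ≤ b i) (hh : ∀ i, 0 ≤ h i)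
    (hV₁ : ‖V₁‖ ≤ 1) (hV₂ : ‖V₂‖ ≤ 1) (hE : ‖E‖ ≤ 1)
    (hX : X = Matrix.diagonal (fun i => (a i : ℂ)) * V₁ * Matrix.diagonal (fun i => (y i : ℂ)) *
      V₂ * Matrix.diagonal (fun i => (b i : ℂ)))
    (hEX : Eᴴ * (Xᴴ * X) * E = Matrix.diagonal fun i => (h i : ℂ)) :
    ∑ i, h i ^ (p / 2) ≤
      √((∑ i, ∑ j, a i ^ (2 * p) * ‖V₁ i j‖ ^ 2 * y j ^ p) *
        (∑ i, ∑ j, y i ^ p * ‖V₂ i j‖ ^ 2 * b j ^ (2 * p))) := by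
  have hp0 : 0 < p := by linarith
  set N := ∑ i, h i ^ (p / 2) with hN
  set S := √((∑ i, ∑ j, a i ^ (2 * p) * ‖V₁ i j‖ ^ 2 * y j ^ p) *
        (∑ i, ∑ j, y i ^ p * ‖V₂ i j‖ ^ 2 * b j ^ (2 * p))) with hS
  have hN0 : 0 ≤ N := Finset.sum_nonneg fun i _ => Real.rpow_nonneg (hh i) _
  have hS0 : 0 ≤ S := Real.sqrt_nonneg _
  let P (x : ι → ℝ) (α β : ℝ) (z : ℂ) : Matrix ι ι ℂ :=
    Matrix.diagonal fun i => analyticPow (x i) (α + β * z)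
  have hPnice (x : ι → ℝ) (α β : ℝ) (i j : ι) : EntireBddOnStrip fun z => P x α β z i j :=
    EntireBddOnStrip.matrix_diagonal
      (fun i => EntireBddOnStrip.analyticPow_affine (x i) α β) i j
  have hPmul (x : ι → ℝ) (α β α' β' : ℝ) (z : ℂ) :
      P x α β z * P x α' β' z = P x (α + α') (β + β') z := by
    simp only [P, Matrix.diagonal_mul_diagonal, analyticPow_mul]
    congr 1
    funext i
    congr 1
    push_cast
    ring
  have hPnorm {x : ι → ℝ} (hx : ∀ i, 0 ≤ x i) (α β : ℝ) (z : ℂ) (i : ι) :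
      ‖analyticPow (x i) (α + β * z)‖ ≤ x i ^ (α + β * z.re) := by
    simpa using norm_analyticPow_le (hx i) (α + β * z)
  have hPunit {x : ι → ℝ} (hx : ∀ i, 0 ≤ x i) (β : ℝ) {z : ℂ} (hz : z.re = 0) :
      ‖P x 0 β z‖ ≤ 1 :=
    norm_diagonal_le_one fun i => by simpa [hz] using hPnorm hx 0 β z i
  have hPreal {x : ι → ℝ} (hx : ∀ i, 0 ≤ x i) :
      P x 0 p ((p⁻¹ : ℝ) : ℂ) = Matrix.diagonal fun i => (x i : ℂ) := by
    simp only [P]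
    congr 1
    funext i
    have : ((0 : ℝ) + (p : ℂ) * ((p⁻¹ : ℝ) : ℂ)) = ((1 : ℝ) : ℂ) := by
      rw [← Complex.ofReal_mul, mul_inv_cancel₀ hp0.ne']
      simp
    rw [this, analyticPow_ofReal (hx i) one_ne_zero, Real.rpow_one]
  let Y (z : ℂ) : Matrix ι ι ℂ := P a 0 p z * V₁ * P y 0 p z * V₂ * P b 0 p z
  let w := (p - 1) / 2 - p / 4
  let φ (z : ℂ) : ℂ := (P h w (-p / 2) z * (X * E)ᴴ * (Y z * E * P h (p / 4) 0 z)).trace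
  have hXE : (X * E)ᴴ * (X * E) = Matrix.diagonal fun i => (h i : ℂ) := by
    rw [← hEX, Matrix.conjTranspose_mul]
    simp only [Matrix.mul_assoc]
  have hconst (M : Matrix ι ι ℂ) (i j : ι) : EntireBddOnStrip fun _ => M i j := .const _
  have hφ : EntireBddOnStrip φ := by
    refine EntireBddOnStrip.sum _ fun i => ?_
    simp only [Matrix.diag_apply]
    refine .matrix_mul (.matrix_mul (hPnice _ _ _) (hconst _)) ?_ i i
    refine .matrix_mul (.matrix_mul ?_ (hconst _)) (hPnice _ _ _)
    exact .matrix_mul (.matrix_mul (.matrix_mul (.matrix_mul (hPnice _ _ _) (hconst _))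
      (hPnice _ _ _)) (hconst _)) (hPnice _ _ _)
  have hmid : φ ((p⁻¹ : ℝ) : ℂ) = N := by
    have hY : Y ((p⁻¹ : ℝ) : ℂ) = X := by
      simp only [Y, hPreal ha, hPreal hy, hPreal hb, hX]
    simp only [φ, hY]
    rw [← Matrix.mul_assoc, Matrix.trace_mul_comm, Matrix.mul_assoc (P h w (-p / 2) _), hXE,
      ← Matrix.mul_assoc, hPmul, Matrix.diagonal_mul_diagonal, Matrix.trace_diagonal, hN,
      Complex.ofReal_sum]
    refine Finset.sum_congr rfl fun i _ => ?_
    rcases (hh i).eq_or_lt with h0 | h0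
    · rw [← h0, analyticPow_zero_left, Real.zero_rpow (by positivity)]
      simp
    · have h1 : ((h i : ℝ) : ℂ) = analyticPow (h i) (1 : ℝ) := by
        rw [analyticPow_ofReal (hh i) one_ne_zero, Real.rpow_one]
      rw [h1, analyticPow_mul, ← analyticPow_ofReal (hh i) (by positivity)]
      congr 1
      norm_cast
      simp only [w]
      field_simp
      ring
  have hzero : ∀ z ∈ Complex.re ⁻¹' {(0 : ℝ)}, ‖φ z‖ ≤ N := by
    intro z hz
    have hz : z.re = 0 := hz
    refine (norm_trace_mul_le _ _).trans ?_
    have h1 : frobeniusSq (P h w (-p / 2) z * (X * E)ᴴ) ≤ N := by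
      have h2 := frobeniusSq_eq_trace (P h w (-p / 2) z * (X * E)ᴴ)
      rw [diagonal_mul_conjTranspose_mul_self hXE, Matrix.trace_diagonal] at h2
      norm_cast at h2
      rw [h2]
      refine Finset.sum_le_sum fun i _ => ?_
      rcases (hh i).eq_or_lt with h0 | h0
      · rw [← h0, mul_zero]
        positivity
      · rw [norm_analyticPow_of_pos h0, ← Real.rpow_natCast, ← Real.rpow_mul (hh i),
          ← Real.rpow_add_one h0.ne']
        apply le_of_eq
        congr 1
        simp [hz, w]
        ring
    have h2 : frobeniusSq (Y z * E * P h (p / 4) 0 z) ≤ N := by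
      refine (frobeniusSq_mul_le _ _ (norm_mul_le_one ?_ hE)).trans ?_
      · exact norm_mul_le_one (norm_mul_le_one (norm_mul_le_one (norm_mul_le_one
          (hPunit ha _ hz) hV₁) (hPunit hy _ hz)) hV₂) (hPunit hb _ hz)
      · rw [frobeniusSq_diagonal]
        refine Finset.sum_le_sum fun i _ => ?_
        refine (pow_le_pow_left₀ (norm_nonneg _) (hPnorm hh _ _ z i) 2).trans_eq ?_
        rw [← Real.rpow_natCast, ← Real.rpow_mul (hh i)]
        congr 1
        push_cast
        ring
    refine (Real.sqrt_le_sqrt (mul_le_mul h1 h2 (frobeniusSq_nonneg _) hN0)).trans ?_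
    rw [Real.sqrt_mul_self hN0]
  have hone : ∀ z ∈ Complex.re ⁻¹' {(1 : ℝ)}, ‖φ z‖ ≤ S := by
    intro z hz
    have hz : z.re = 1 := hz
    have hsplit : φ z = (P h (p / 4) 0 z * P h w (-p / 2) z * (X * E)ᴴ *
        (P a 0 p z * V₁ * P y 0 (p / 2) z) *
          (P y 0 (p / 2) z * V₂ * P b 0 p z * E)).trace := by
      have h1 : P y 0 p z = P y 0 (p / 2) z * P y 0 (p / 2) z := by
        rw [hPmul, add_zero, add_halves]
      simp only [φ, Y]
      rw [← Matrix.mul_assoc, Matrix.trace_mul_comm, h1]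
      simp only [Matrix.mul_assoc]
    rw [hsplit]
    refine (norm_trace_mul_le _ _).trans (Real.sqrt_le_sqrt ?_)
    have hc {x : ι → ℝ} (hx : ∀ i, 0 ≤ x i) (β : ℝ) (i : ι) :
        ‖analyticPow (x i) ((0 : ℝ) + β * z)‖ ^ 2 ≤ x i ^ (2 * β) := by
      refine (pow_le_pow_left₀ (norm_nonneg _) (hPnorm hx _ _ z i) 2).trans_eq ?_
      rw [← Real.rpow_natCast, ← Real.rpow_mul (hx i), hz]
      congr 1
      push_cast
      ring
    have hc' (i : ι) : ‖analyticPow (y i) ((0 : ℝ) + (p / 2 : ℝ) * z)‖ ^ 2 ≤ y i ^ p := by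
      simpa [mul_div_cancel₀] using hc hy (p / 2) i
    refine mul_le_mul ((frobeniusSq_mul_le _ _ ?_).trans
      (frobeniusSq_diagonal_mul_mul_diagonal_le _ (hc ha p) hc'))
      ((frobeniusSq_mul_le_right _ _ hE).trans
      (frobeniusSq_diagonal_mul_mul_diagonal_le _ hc' (hc hb p)))
      (frobeniusSq_nonneg _) ?_
    · rw [hPmul, ← Matrix.l2_opNorm_conjTranspose]
      refine norm_le_one_of_conjTranspose_mul_self
        (d := fun i => (‖analyticPow (h i) ((p / 4 + w : ℝ) + (0 + -p / 2 : ℝ) * z)‖ ^ 2 * h i : ℝ))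
        ?_ fun i => ?_
      · rw [Matrix.conjTranspose_conjTranspose, diagonal_mul_conjTranspose_mul_self hXE]
      · rcases (hh i).eq_or_lt with h0 | h0
        · simp [← h0]
        · rw [norm_analyticPow_of_pos h0, ← Real.rpow_natCast, ← Real.rpow_mul (hh i),
            ← Real.rpow_add_one h0.ne', Complex.norm_real, Real.norm_of_nonneg (by positivity)]
          apply le_of_eq
          convert Real.rpow_zero (h i) using 2
          simp [hz, w]
          ring
    · exact Finset.sum_nonneg fun i _ => Finset.sum_nonneg fun j _ =>
        mul_nonneg (mul_nonneg (Real.rpow_nonneg (ha i) _) (sq_nonneg _))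
          (Real.rpow_nonneg (hy j) _)
  have hpi : 0 ≤ p⁻¹ ∧ p⁻¹ ≤ 1 := ⟨by positivity, inv_le_one_of_one_le₀ hp⟩
  have hbdd : BddAbove ((norm ∘ φ) '' Complex.HadamardThreeLines.verticalClosedStrip 0 1) := by
    obtain ⟨C, hC⟩ := hφ.2
    refine ⟨C, ?_⟩
    rintro _ ⟨z, hz, rfl⟩
    exact hC z hz
  have key := Complex.HadamardThreeLines.norm_le_interp_of_mem_verticalClosedStrip₀₁' φ
    (z := ((p⁻¹ : ℝ) : ℂ)) (by simpa [Complex.HadamardThreeLines.verticalClosedStrip] using hpi)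
    hφ.1.diffContOnCl hbdd hzero hone
  rw [hmid, Complex.norm_real, Real.norm_of_nonneg hN0, Complex.ofReal_re] at key
  rcases hN0.eq_or_lt with h0 | h0
  · rw [← h0]; exact hS0
  · rw [Real.rpow_sub h0, Real.rpow_one, div_mul_eq_mul_div, le_div_iff₀ (by positivity)] at key
    have h1 := le_of_mul_le_mul_left key h0
    exact (Real.rpow_le_rpow_iff hN0 hS0 (by positivity)).1 h1

end ThreeLines

section Spectral

variable {ι : Type*} [Fintype ι] [DecidableEq ι]

lemma Matrix.IsHermitian.eq_conj_diagonal {M : Matrix ι ι ℂ} (hM : M.IsHermitian) :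
    M = (hM.eigenvectorUnitary : Matrix ι ι ℂ) *
      Matrix.diagonal (fun i => (hM.eigenvalues i : ℂ)) *
        (hM.eigenvectorUnitary : Matrix ι ι ℂ)ᴴ := by
  have h := hM.spectral_theorem
  rw [Unitary.conjStarAlgAut_apply] at h
  exact h

lemma Matrix.IsHermitian.conj_eigenvectorUnitary {M : Matrix ι ι ℂ} (hM : M.IsHermitian) :
    (hM.eigenvectorUnitary : Matrix ι ι ℂ)ᴴ * M * (hM.eigenvectorUnitary : Matrix ι ι ℂ) =
      Matrix.diagonal fun i => (hM.eigenvalues i : ℂ) := by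
  have h1 : (hM.eigenvectorUnitary : Matrix ι ι ℂ)ᴴ * hM.eigenvectorUnitary = 1 :=
    Matrix.mem_unitaryGroup_iff'.1 hM.eigenvectorUnitary.2
  have h2 := congrArg (fun N => (hM.eigenvectorUnitary : Matrix ι ι ℂ)ᴴ * N *
    (hM.eigenvectorUnitary : Matrix ι ι ℂ)) hM.eq_conj_diagonal
  refine h2.trans ?_
  simp only [Matrix.mul_assoc, h1, Matrix.mul_one]
  rw [← Matrix.mul_assoc, h1, Matrix.one_mul]

lemma Matrix.IsHermitian.sum_eigenvalues_eq {M : Matrix ι ι ℂ} (hM : M.IsHermitian)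
    {U : Matrix ι ι ℂ} (hU : U ∈ Matrix.unitaryGroup ι ℂ) {d : ι → ℝ}
    (hd : M = U * Matrix.diagonal (fun i => (d i : ℂ)) * Uᴴ) (f : ℝ → ℝ) :
    ∑ i, f (hM.eigenvalues i) = ∑ i, f (d i) := by
  have h1 : M.charpoly = (Matrix.diagonal fun i => (d i : ℂ)).charpoly := by
    rw [hd, Matrix.mul_assoc, Matrix.charpoly_mul_comm, Matrix.mul_assoc,
      show Uᴴ * U = 1 from Matrix.mem_unitaryGroup_iff'.1 hU, Matrix.mul_one]
  have h2 := hM.roots_charpoly_eq_eigenvalues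
  rw [h1, Matrix.charpoly_diagonal, Polynomial.roots_prod _ _ (by
    simp [Finset.prod_ne_zero_iff, Polynomial.X_sub_C_ne_zero])] at h2
  simp only [Polynomial.roots_X_sub_C, Multiset.bind_singleton] at h2
  have h3 := congrArg (fun s => (s.map fun c : ℂ => f c.re).sum) h2
  simpa using h3.symm

lemma schattenNorm_congr (p : ℝ≥0∞) {X Z : Matrix ι ι ℂ}
    (h : (Xᴴ * X).charpoly = (Zᴴ * Z).charpoly) : schattenNorm p X = schattenNorm p Z := by
  unfold schattenNorm
  rw [(Matrix.IsHermitian.eigenvalues_eq_eigenvalues_iff _ _).2 h]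

lemma schattenNorm_conjTranspose (p : ℝ≥0∞) (X : Matrix ι ι ℂ) :
    schattenNorm p Xᴴ = schattenNorm p X :=
  schattenNorm_congr p (by rw [Matrix.conjTranspose_conjTranspose, Matrix.charpoly_mul_comm])

lemma schattenNorm_nonneg (p : ℝ≥0∞) (X : Matrix ι ι ℂ) : 0 ≤ schattenNorm p X := by
  unfold schattenNorm
  split_ifs
  · exact Real.iSup_nonneg fun i => Real.sqrt_nonneg _
  · exact Real.rpow_nonneg (Finset.sum_nonneg fun i _ => Real.rpow_nonneg
      ((Matrix.posSemidef_conjTranspose_mul_self X).eigenvalues_nonneg i) _) _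

lemma schattenNorm_of_conjTranspose_mul_self_eq {p : ℝ≥0∞} (hp : p ≠ ⊤) {X U : Matrix ι ι ℂ}
    (hU : U ∈ Matrix.unitaryGroup ι ℂ) {d : ι → ℝ}
    (hd : Xᴴ * X = U * Matrix.diagonal (fun i => (d i : ℂ)) * Uᴴ) :
    schattenNorm p X = (∑ i, d i ^ (p.toReal / 2)) ^ (1 / p.toReal) := by
  rw [schattenNorm, if_neg hp,
    (Matrix.posSemidef_conjTranspose_mul_self X).isHermitian.sum_eigenvalues_eq hU hd
      fun x => x ^ (p.toReal / 2)]

lemma re_trace_conj_diagonal_mul (U S : Matrix ι ι ℂ) (a y : ι → ℝ) :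
    (U * Matrix.diagonal (fun i => (a i : ℂ)) * Uᴴ *
      (S * Matrix.diagonal (fun i => (y i : ℂ)) * Sᴴ)).trace.re =
      ∑ i, ∑ j, a i * ‖(Uᴴ * S) i j‖ ^ 2 * y j := by
  have h1 : (U * Matrix.diagonal (fun i => (a i : ℂ)) * Uᴴ *
      (S * Matrix.diagonal (fun i => (y i : ℂ)) * Sᴴ)).trace =
      (Matrix.diagonal (fun i => (a i : ℂ)) * (Uᴴ * S) * Matrix.diagonal (fun i => (y i : ℂ)) *
        (Uᴴ * S)ᴴ).trace := by
    rw [Matrix.mul_assoc, Matrix.mul_assoc, Matrix.trace_mul_comm, Matrix.conjTranspose_mul,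
      Matrix.conjTranspose_conjTranspose]
    simp only [Matrix.mul_assoc]
  rw [h1]
  simp only [Matrix.trace, Matrix.diag_apply, Matrix.mul_apply (N := (Uᴴ * S)ᴴ),
    Matrix.mul_diagonal, Matrix.diagonal_mul, Complex.re_sum, Matrix.conjTranspose_apply]
  refine Finset.sum_congr rfl fun i _ => Finset.sum_congr rfl fun j _ => ?_
  rw [← Complex.ofReal_re (a i * ‖(Uᴴ * S) i j‖ ^ 2 * y j)]
  congr 1
  push_cast
  rw [← Complex.conj_mul', Complex.star_def]
  ring

lemma sum_norm_sq_row {V : Matrix ι ι ℂ} (hV : V ∈ Matrix.unitaryGroup ι ℂ) (i : ι) :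
    ∑ j, ‖V i j‖ ^ 2 = 1 := by
  have h := congrFun (congrFun (Matrix.mem_unitaryGroup_iff.1 hV) i) i
  rw [Matrix.mul_apply, Matrix.one_apply_eq] at h
  have h2 : ((∑ j, ‖V i j‖ ^ 2 : ℝ) : ℂ) = 1 := by
    rw [← h]
    push_cast
    refine Finset.sum_congr rfl fun j _ => ?_
    rw [← Complex.mul_conj', Matrix.star_apply, Complex.star_def]
  exact_mod_cast h2

lemma sum_norm_sq_col {V : Matrix ι ι ℂ} (hV : V ∈ Matrix.unitaryGroup ι ℂ) (j : ι) :
    ∑ i, ‖V i j‖ ^ 2 = 1 := by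
  have h := sum_norm_sq_row (V := star V) (Unitary.star_mem hV) j
  simpa [Matrix.star_apply] using h

/-- Hölder's inequality for the trace of a product of positive matrices, in eigenbases. -/
lemma sum_mul_norm_sq_mul_le_of_holderConjugate {V : Matrix ι ι ℂ}
    (hV : V ∈ Matrix.unitaryGroup ι ℂ) {u v : ℝ} (huv : u.HolderConjugate v) {a s : ι → ℝ}
    (ha : ∀ i, 0 ≤ a i) (hs : ∀ i, 0 ≤ s i) :
    ∑ i, ∑ j, a i * ‖V i j‖ ^ 2 * s j ≤
      (∑ i, a i ^ u) ^ (1 / u) * (∑ j, s j ^ v) ^ (1 / v) := by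
  have hu := huv.pos
  have hv := huv.symm.pos
  have hc (i j : ι) : 0 ≤ ‖V i j‖ ^ 2 := by positivity
  have h := Real.inner_le_Lp_mul_Lq_of_nonneg (Finset.univ : Finset (ι × ι)) huv
    (f := fun x => a x.1 * (‖V x.1 x.2‖ ^ 2) ^ (1 / u))
    (g := fun x => s x.2 * (‖V x.1 x.2‖ ^ 2) ^ (1 / v))
    (fun x _ => mul_nonneg (ha _) (Real.rpow_nonneg (hc _ _) _))
    (fun x _ => mul_nonneg (hs _) (Real.rpow_nonneg (hc _ _) _))
  have e1 (i j : ι) : a i * (‖V i j‖ ^ 2) ^ (1 / u) * (s j * (‖V i j‖ ^ 2) ^ (1 / v)) =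
      a i * ‖V i j‖ ^ 2 * s j := by
    have : (‖V i j‖ ^ 2) ^ (1 / u) * (‖V i j‖ ^ 2) ^ (1 / v) = ‖V i j‖ ^ 2 := by
      rw [← Real.rpow_add_of_nonneg (hc i j) (by positivity) (by positivity), one_div, one_div,
        huv.inv_add_inv_eq_one, Real.rpow_one]
    linear_combination a i * s j * this
  have e2 (i j : ι) : (a i * (‖V i j‖ ^ 2) ^ (1 / u)) ^ u = a i ^ u * ‖V i j‖ ^ 2 := by
    rw [Real.mul_rpow (ha i) (Real.rpow_nonneg (hc i j) _), ← Real.rpow_mul (hc i j),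
      one_div_mul_cancel hu.ne', Real.rpow_one]
  have e3 (i j : ι) : (s j * (‖V i j‖ ^ 2) ^ (1 / v)) ^ v = s j ^ v * ‖V i j‖ ^ 2 := by
    rw [Real.mul_rpow (hs j) (Real.rpow_nonneg (hc i j) _), ← Real.rpow_mul (hc i j),
      one_div_mul_cancel hv.ne', Real.rpow_one]
  simp only [Fintype.sum_prod_type, e1, e2, e3] at h
  rw [Finset.sum_comm (f := fun i j => s j ^ v * ‖V i j‖ ^ 2)] at h
  simpa only [← Finset.mul_sum, sum_norm_sq_row hV, sum_norm_sq_col hV, mul_one] using h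

lemma mrpow_eq {M : Matrix ι ι ℂ} (hM : M.IsHermitian) (e : ℝ) :
    mrpow M e = (hM.eigenvectorUnitary : Matrix ι ι ℂ) *
      Matrix.diagonal (fun i => ((hM.eigenvalues i ^ e : ℝ) : ℂ)) *
        (hM.eigenvectorUnitary : Matrix ι ι ℂ)ᴴ :=
  dif_pos hM

lemma posSemidef_mrpow {M : Matrix ι ι ℂ} (hM : M.PosSemidef) (e : ℝ) :
    (mrpow M e).PosSemidef := by
  rw [mrpow_eq hM.isHermitian]
  refine Matrix.PosSemidef.mul_mul_conjTranspose_same (Matrix.PosSemidef.diagonal fun i => ?_) _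
  exact Complex.zero_le_real.2 (Real.rpow_nonneg (hM.eigenvalues_nonneg i) _)

lemma trace_mrpow {M : Matrix ι ι ℂ} (hM : M.IsHermitian) (e : ℝ) :
    (mrpow M e).trace = (∑ i, hM.eigenvalues i ^ e : ℝ) := by
  rw [mrpow_eq hM, Matrix.trace_mul_comm, ← Matrix.mul_assoc,
    show (hM.eigenvectorUnitary : Matrix ι ι ℂ)ᴴ * hM.eigenvectorUnitary = 1 from
      Matrix.mem_unitaryGroup_iff'.1 hM.eigenvectorUnitary.2, Matrix.one_mul,
    Matrix.trace_diagonal, Complex.ofReal_sum]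

/-- A generalized Araki–Lieb–Thirring inequality for Schatten norms of `A * Y * B` with `Y`
positive semidefinite. -/
theorem schattenNorm_mul_mul_le {p : ℝ} (hp : 1 ≤ p) {A B Y U W : Matrix ι ι ℂ} {a b : ι → ℝ}
    (hY : Y.PosSemidef) (ha : ∀ i, 0 ≤ a i) (hb : ∀ i, 0 ≤ b i)
    (hU : U ∈ Matrix.unitaryGroup ι ℂ) (hW : W ∈ Matrix.unitaryGroup ι ℂ)
    (hA : Aᴴ * A = U * Matrix.diagonal (fun i => ((a i ^ 2 : ℝ) : ℂ)) * Uᴴ)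
    (hB : B * Bᴴ = W * Matrix.diagonal (fun i => ((b i ^ 2 : ℝ) : ℂ)) * Wᴴ) :
    schattenNorm (ENNReal.ofReal p) (A * Y * B) ≤
      ((U * Matrix.diagonal (fun i => ((a i ^ (2 * p) : ℝ) : ℂ)) * Uᴴ * mrpow Y p).trace.re *
        (W * Matrix.diagonal (fun i => ((b i ^ (2 * p) : ℝ) : ℂ)) * Wᴴ * mrpow Y p).trace.re) ^
          (1 / (2 * p)) := by
  have hp0 : 0 < p := by linarith
  have hYh := hY.isHermitian
  set S : Matrix ι ι ℂ := (hYh.eigenvectorUnitary : Matrix ι ι ℂ) with hS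
  have hSu : S ∈ Matrix.unitaryGroup ι ℂ := hYh.eigenvectorUnitary.2
  have hYS := hYh.eq_conj_diagonal
  rw [← hS] at hYS
  let D (x : ι → ℝ) : Matrix ι ι ℂ := Matrix.diagonal fun i => (x i : ℂ)
  have hDstar (x : ι → ℝ) : (D x)ᴴ = D x := by
    simp only [D, Matrix.diagonal_conjTranspose]
    congr 1
    funext i
    simp
  have hDsq (x : ι → ℝ) : D x * D x = D fun i => x i ^ 2 := by
    simp only [D, Matrix.diagonal_mul_diagonal, sq, Complex.ofReal_mul]
  let X : Matrix ι ι ℂ := D a * Uᴴ * Y * W * D b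
  have hX1 : (A * Y * B)ᴴ * (A * Y * B) = (D a * Uᴴ * Y * B)ᴴ * (D a * Uᴴ * Y * B) := by
    calc (A * Y * B)ᴴ * (A * Y * B) = Bᴴ * Yᴴ * (Aᴴ * A) * Y * B := by
          simp only [Matrix.conjTranspose_mul, Matrix.mul_assoc]
      _ = Bᴴ * Yᴴ * (U * (D a * D a) * Uᴴ) * Y * B := by rw [hA, hDsq]
      _ = _ := by
          simp only [Matrix.conjTranspose_mul, Matrix.mul_assoc, hDstar,
            Matrix.conjTranspose_conjTranspose]
  have hX2 : (D a * Uᴴ * Y * B) * (D a * Uᴴ * Y * B)ᴴ = X * Xᴴ := by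
    calc (D a * Uᴴ * Y * B) * (D a * Uᴴ * Y * B)ᴴ
        = D a * Uᴴ * Y * (B * Bᴴ) * Yᴴ * U * D a := by
          simp only [Matrix.conjTranspose_mul, Matrix.mul_assoc, hDstar,
            Matrix.conjTranspose_conjTranspose]
      _ = D a * Uᴴ * Y * (W * (D b * D b) * Wᴴ) * Yᴴ * U * D a := by rw [hB, hDsq]
      _ = _ := by
          simp only [X, Matrix.conjTranspose_mul, Matrix.mul_assoc, hDstar,
            Matrix.conjTranspose_conjTranspose]
  rw [schattenNorm_congr (Z := X) _ (by
    rw [hX1, Matrix.charpoly_mul_comm, hX2, Matrix.charpoly_mul_comm])]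
  have hH := Matrix.posSemidef_conjTranspose_mul_self X
  rw [schattenNorm, if_neg ENNReal.ofReal_ne_top, ENNReal.toReal_ofReal hp0.le]
  have hEu := hH.isHermitian.eigenvectorUnitary.2
  have hEX := hH.isHermitian.conj_eigenvectorUnitary
  have hUS : Uᴴ * S ∈ Matrix.unitaryGroup ι ℂ := mul_mem (Unitary.star_mem hU) hSu
  have hSW : Sᴴ * W ∈ Matrix.unitaryGroup ι ℂ := mul_mem (Unitary.star_mem hSu) hW
  have key := sum_rpow_half_le_sqrt hp ha hY.eigenvalues_nonneg hb hH.eigenvalues_nonneg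
    (norm_le_one_of_mem_unitaryGroup hUS) (norm_le_one_of_mem_unitaryGroup hSW)
    (norm_le_one_of_mem_unitaryGroup hEu) (X := X) (by
      simp only [X, D]
      nth_rewrite 1 [hYS]
      simp only [Matrix.mul_assoc]) hEX
  rw [mrpow_eq hYh, ← hS, re_trace_conj_diagonal_mul, re_trace_conj_diagonal_mul]
  have hcomm : ∑ i, ∑ j, hYh.eigenvalues i ^ p * ‖(Sᴴ * W) i j‖ ^ 2 * b j ^ (2 * p) =
      ∑ i, ∑ j, b i ^ (2 * p) * ‖(Wᴴ * S) i j‖ ^ 2 * hYh.eigenvalues j ^ p := by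
    rw [Finset.sum_comm]
    refine Finset.sum_congr rfl fun i _ => Finset.sum_congr rfl fun j _ => ?_
    have : (Wᴴ * S) i j = star ((Sᴴ * W) j i) := by
      rw [← Matrix.conjTranspose_apply, Matrix.conjTranspose_mul,
        Matrix.conjTranspose_conjTranspose]
    rw [this, norm_star]
    ring
  rw [hcomm] at key
  refine (Real.rpow_le_rpow (Finset.sum_nonneg fun i _ => Real.rpow_nonneg
    (hH.eigenvalues_nonneg i) _) key (by positivity)).trans_eq ?_
  rw [Real.sqrt_eq_rpow, ← Real.rpow_mul]
  · congr 1
    field_simp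
  · have h0 (x y : ι → ℝ) (c : ι → ι → ℝ) (hx : ∀ i, 0 ≤ x i) (hy : ∀ i, 0 ≤ y i) :
        0 ≤ ∑ i, ∑ j, x i ^ (2 * p) * c i j ^ 2 * y j ^ p :=
      Finset.sum_nonneg fun i _ => Finset.sum_nonneg fun j _ =>
        mul_nonneg (mul_nonneg (Real.rpow_nonneg (hx i) _) (sq_nonneg _))
          (Real.rpow_nonneg (hy j) _)
    exact mul_nonneg (h0 _ _ _ ha hY.eigenvalues_nonneg) (h0 _ _ _ hb hY.eigenvalues_nonneg)

end Spectral

section NCNorm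

lemma trace_kronecker_one_mul {k l : Type*} [Fintype k] [Fintype l] [DecidableEq l]
    (C : Matrix k k ℂ) (P : Matrix (k × l) (k × l) ℂ) :
    ((C ⊗ₖ (1 : Matrix l l ℂ)) * P).trace = (C * ptrace2 P).trace := by
  simp only [Matrix.trace, Matrix.diag_apply, Matrix.mul_apply, ptrace2, Fintype.sum_prod_type,
    Matrix.kronecker_apply, Matrix.one_apply, mul_ite, mul_one, mul_zero, ite_mul, zero_mul,
    Finset.sum_ite_eq, Finset.mem_univ, if_true, Finset.mul_sum]
  exact Finset.sum_congr rfl fun i _ => Finset.sum_comm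

lemma posSemidef_ptrace2 {k l : Type*} [Fintype l] {P : Matrix (k × l) (k × l) ℂ}
    (hP : P.PosSemidef) :
    (ptrace2 P).PosSemidef := by
  have h : ptrace2 P = ∑ j, P.submatrix (fun i => (i, j)) fun i => (i, j) := by
    ext i i'
    simp [ptrace2, Matrix.sum_apply]
  rw [h]
  exact Matrix.posSemidef_sum _ fun j _ => hP.submatrix _

variable {k l : Type*} [Fintype k] [DecidableEq k] [Fintype l] [DecidableEq l]

lemma conj_diagonal_kronecker_one (U : Matrix k k ℂ) (d : k → ℂ) :
    (U * Matrix.diagonal d * Uᴴ) ⊗ₖ (1 : Matrix l l ℂ) =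
      (U ⊗ₖ (1 : Matrix l l ℂ)) * Matrix.diagonal (fun x : k × l => d x.1) *
        (U ⊗ₖ (1 : Matrix l l ℂ))ᴴ := by
  have h : Matrix.diagonal (fun x : k × l => d x.1) =
      Matrix.diagonal d ⊗ₖ (1 : Matrix l l ℂ) := by
    rw [← Matrix.diagonal_one, Matrix.diagonal_kronecker_diagonal]
    simp
  rw [h, Matrix.conjTranspose_kronecker, Matrix.conjTranspose_one, ← Matrix.mul_kronecker_mul,
    ← Matrix.mul_kronecker_mul, Matrix.mul_one, Matrix.mul_one]

lemma Psi_eq {p q : ℝ} {Y : Matrix (k × l) (k × l) ℂ} (h : (ptrace2 (mrpow Y p)).IsHermitian) :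
    Psi p q Y = (∑ i, h.eigenvalues i ^ (q / p)) ^ (1 / q) := by
  rw [Psi, trace_mrpow h, Complex.ofReal_re]

lemma schattenNorm_kronecker_mul_mul_le {p : ℝ} (hp : 1 ≤ p) {A B U W : Matrix k k ℂ}
    {Y : Matrix (k × l) (k × l) ℂ} {a b : k → ℝ} (hY : Y.PosSemidef)
    (ha : ∀ i, 0 ≤ a i) (hb : ∀ i, 0 ≤ b i)
    (hU : U ∈ Matrix.unitaryGroup k ℂ) (hW : W ∈ Matrix.unitaryGroup k ℂ)
    (hA : Aᴴ * A = U * Matrix.diagonal (fun i => ((a i ^ 2 : ℝ) : ℂ)) * Uᴴ)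
    (hB : B * Bᴴ = W * Matrix.diagonal (fun i => ((b i ^ 2 : ℝ) : ℂ)) * Wᴴ) :
    schattenNorm (ENNReal.ofReal p)
        ((A ⊗ₖ (1 : Matrix l l ℂ)) * Y * (B ⊗ₖ (1 : Matrix l l ℂ))) ≤
      ((U * Matrix.diagonal (fun i => ((a i ^ (2 * p) : ℝ) : ℂ)) * Uᴴ *
          ptrace2 (mrpow Y p)).trace.re *
        (W * Matrix.diagonal (fun i => ((b i ^ (2 * p) : ℝ) : ℂ)) * Wᴴ *
          ptrace2 (mrpow Y p)).trace.re) ^ (1 / (2 * p)) := by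
  have h1 : (1 : Matrix l l ℂ) ∈ Matrix.unitaryGroup l ℂ := one_mem _
  have h := schattenNorm_mul_mul_le hp (a := fun x : k × l => a x.1) (b := fun x : k × l => b x.1)
    (A := A ⊗ₖ (1 : Matrix l l ℂ)) (B := B ⊗ₖ (1 : Matrix l l ℂ)) hY
    (fun x => ha x.1) (fun x => hb x.1)
    (Matrix.kronecker_mem_unitary hU h1) (Matrix.kronecker_mem_unitary hW h1)
    (by rw [← conj_diagonal_kronecker_one U fun i => ((a i ^ 2 : ℝ) : ℂ), ← hA,
          Matrix.conjTranspose_kronecker, Matrix.conjTranspose_one, ← Matrix.mul_kronecker_mul,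
          Matrix.mul_one])
    (by rw [← conj_diagonal_kronecker_one W fun i => ((b i ^ 2 : ℝ) : ℂ), ← hB,
          Matrix.conjTranspose_kronecker, Matrix.conjTranspose_one, ← Matrix.mul_kronecker_mul,
          Matrix.mul_one])
  rwa [← conj_diagonal_kronecker_one U fun i => ((a i ^ (2 * p) : ℝ) : ℂ),
    ← conj_diagonal_kronecker_one W fun i => ((b i ^ (2 * p) : ℝ) : ℂ),
    trace_kronecker_one_mul, trace_kronecker_one_mul] at h

lemma ncR_comm (p q : ℝ≥0∞) : ncR p q = ncR q p := by
  rw [ncR, ncR, max_comm, min_comm]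

lemma ncR_self (p : ℝ≥0∞) : ncR p p = ⊤ := by simp [ncR]

lemma two_mul_ncR_ofReal {p q : ℝ} (hp : 0 < p) (hpq : p < q) :
    2 * ncR (ENNReal.ofReal p) (ENNReal.ofReal q) = ENNReal.ofReal (2 * p * q / (q - p)) := by
  have hq : 0 < q := hp.trans hpq
  have h1 : q⁻¹ ≤ p⁻¹ := inv_anti₀ hp hpq.le
  have h2 : 0 < p⁻¹ - q⁻¹ := sub_pos.2 (inv_strictAnti₀ hp hpq)
  rw [ncR, ← ENNReal.ofReal_inv_of_pos hp, ← ENNReal.ofReal_inv_of_pos hq,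
    max_eq_left (ENNReal.ofReal_le_ofReal h1), min_eq_right (ENNReal.ofReal_le_ofReal h1),
    ← ENNReal.ofReal_sub _ (by positivity), ← ENNReal.ofReal_inv_of_pos h2,
    ← ENNReal.ofReal_ofNat, ← ENNReal.ofReal_mul zero_le_two]
  congr 1
  have : q - p ≠ 0 := (sub_pos.2 hpq).ne'
  field_simp

/-- Hölder's inequality `Tr |A|^{2p} σ ≤ ‖A‖_{2r}^{2p} (Tr σ^{q/p})^{p/q}`, for `p ≤ q`. -/
lemma re_trace_conj_diagonal_mul_le {p q : ℝ} (hp : 0 < p) (hpq : p ≤ q) (A : Matrix k k ℂ)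
    {σ : Matrix k k ℂ} (hσ : σ.PosSemidef) :
    ((Matrix.posSemidef_conjTranspose_mul_self A).isHermitian.eigenvectorUnitary *
        Matrix.diagonal (fun i =>
          ((√((Matrix.posSemidef_conjTranspose_mul_self A).isHermitian.eigenvalues i) ^ (2 * p)
            : ℝ) : ℂ)) *
      ((Matrix.posSemidef_conjTranspose_mul_self A).isHermitian.eigenvectorUnitary :
        Matrix k k ℂ)ᴴ * σ).trace.re ≤
      schattenNorm (2 * ncR (ENNReal.ofReal p) (ENNReal.ofReal q)) A ^ (2 * p) *
        (∑ i, hσ.isHermitian.eigenvalues i ^ (q / p)) ^ (p / q) := by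
  have hH := Matrix.posSemidef_conjTranspose_mul_self A
  set e := (Matrix.posSemidef_conjTranspose_mul_self A).isHermitian.eigenvalues with he
  set U : Matrix k k ℂ :=
    ((Matrix.posSemidef_conjTranspose_mul_self A).isHermitian.eigenvectorUnitary :
      Matrix k k ℂ) with hU
  have he0 : ∀ i, 0 ≤ e i := hH.eigenvalues_nonneg
  set s := hσ.isHermitian.eigenvalues with hs
  have hs0 : ∀ i, 0 ≤ s i := hσ.eigenvalues_nonneg
  set S : Matrix k k ℂ := (hσ.isHermitian.eigenvectorUnitary : Matrix k k ℂ) with hS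
  have hUS : Uᴴ * S ∈ Matrix.unitaryGroup k ℂ :=
    mul_mem (Unitary.star_mem (Subtype.property _)) (Subtype.property _)
  have hσS : σ = S * Matrix.diagonal (fun i => (s i : ℂ)) * Sᴴ := hσ.isHermitian.eq_conj_diagonal
  rw [hσS, re_trace_conj_diagonal_mul]
  rcases hpq.eq_or_lt with rfl | hlt
  · rw [ncR_self, ENNReal.mul_top two_ne_zero, div_self hp.ne', Real.rpow_one]
    have hle (i : k) : √(e i) ≤ schattenNorm ⊤ A := by
      rw [schattenNorm, if_pos rfl]
      exact le_ciSup (f := fun i => √(e i)) (Set.finite_range _).bddAbove i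
    calc ∑ i, ∑ j, √(e i) ^ (2 * p) * ‖(Uᴴ * S) i j‖ ^ 2 * s j
        ≤ ∑ i, ∑ j, schattenNorm ⊤ A ^ (2 * p) * ‖(Uᴴ * S) i j‖ ^ 2 * s j := by
          gcongr with i _ j _
          · exact hs0 j
          · exact hle i
      _ = schattenNorm ⊤ A ^ (2 * p) * ∑ i, s i ^ (1 : ℝ) := by
          rw [Finset.sum_comm, Finset.mul_sum]
          refine Finset.sum_congr rfl fun j _ => ?_
          rw [← Finset.sum_mul, ← Finset.mul_sum, sum_norm_sq_col hUS, mul_one, Real.rpow_one]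
  · have hq : 0 < q := hp.trans hlt
    have hd : 0 < q - p := sub_pos.2 hlt
    rw [two_mul_ncR_ofReal hp hlt, schattenNorm, if_neg ENNReal.ofReal_ne_top,
      ENNReal.toReal_ofReal (by positivity), ← he]
    have huv : (q / (q - p)).HolderConjugate (q / p) := by
      rw [Real.holderConjugate_iff]
      refine ⟨(one_lt_div hd).2 (by linarith), ?_⟩
      field_simp
      ring
    refine (sum_mul_norm_sq_mul_le_of_holderConjugate hUS huv
      (fun i => Real.rpow_nonneg (Real.sqrt_nonneg _) _) hs0).trans_eq ?_
    congr 1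
    · rw [← Real.rpow_mul (Finset.sum_nonneg fun i _ => Real.rpow_nonneg (he0 i) _)]
      congr 1
      · refine Finset.sum_congr rfl fun i _ => ?_
        rw [← Real.rpow_mul (Real.sqrt_nonneg _), Real.sqrt_eq_rpow, ← Real.rpow_mul (he0 i)]
        congr 1
        field_simp
      · field_simp
    · rw [one_div_div]

lemma Psi_nonneg {p q : ℝ} {Y : Matrix (k × l) (k × l) ℂ} (hY : Y.PosSemidef) :
    0 ≤ Psi p q Y := by
  have h := posSemidef_ptrace2 (posSemidef_mrpow hY p)
  rw [Psi_eq h.isHermitian]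
  exact Real.rpow_nonneg (Finset.sum_nonneg fun i _ => Real.rpow_nonneg
    (h.eigenvalues_nonneg i) _) _

theorem ncNormSup_le_Psi {p q : ℝ} (hp : 1 ≤ p) (hpq : p ≤ q) {Y : Matrix (k × l) (k × l) ℂ}
    (hY : Y.PosSemidef) :
    ncNormSup (ENNReal.ofReal p) (ENNReal.ofReal q) Y ≤ Psi p q Y := by
  have hp0 : 0 < p := by linarith
  have hq0 : 0 < q := by linarith
  have hΨ : 0 ≤ Psi p q Y := Psi_nonneg hY
  have hσ := posSemidef_ptrace2 (posSemidef_mrpow hY p)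
  refine Real.iSup_le (fun A => Real.iSup_le (fun B => ?_) hΨ) hΨ
  set R := 2 * ncR (ENNReal.ofReal p) (ENNReal.ofReal q) with hR
  have hA0 := schattenNorm_nonneg R A
  have hB0 := schattenNorm_nonneg R B
  refine div_le_of_le_mul₀ (mul_nonneg hA0 hB0) hΨ ?_
  have hAA := Matrix.posSemidef_conjTranspose_mul_self A
  have hBB := Matrix.posSemidef_conjTranspose_mul_self Bᴴ
  have hsq {M : Matrix k k ℂ} (hM : M.PosSemidef) :
      M = (hM.isHermitian.eigenvectorUnitary : Matrix k k ℂ) *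
        Matrix.diagonal (fun i => ((√(hM.isHermitian.eigenvalues i) ^ 2 : ℝ) : ℂ)) *
          (hM.isHermitian.eigenvectorUnitary : Matrix k k ℂ)ᴴ := by
    simp only [Real.sq_sqrt (hM.eigenvalues_nonneg _)]
    exact hM.isHermitian.eq_conj_diagonal
  refine (schattenNorm_kronecker_mul_mul_le hp hY (fun i => Real.sqrt_nonneg _)
    (fun i => Real.sqrt_nonneg _) (Subtype.property _) (Subtype.property _) (hsq hAA)
    ((congrArg (· * Bᴴ) (Matrix.conjTranspose_conjTranspose B).symm).trans (hsq hBB))).trans ?_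
  have hA := re_trace_conj_diagonal_mul_le hp0 hpq A hσ
  have hB := re_trace_conj_diagonal_mul_le hp0 hpq Bᴴ hσ
  rw [← hR] at hA hB
  rw [schattenNorm_conjTranspose] at hB
  have hs0 : 0 ≤ ∑ i, hσ.isHermitian.eigenvalues i ^ (q / p) :=
    Finset.sum_nonneg fun i _ => Real.rpow_nonneg (hσ.eigenvalues_nonneg i) _
  have hnonneg {M : Matrix k k ℂ} (hM : M.PosSemidef) :
      0 ≤ ((hM.isHermitian.eigenvectorUnitary : Matrix k k ℂ) *
        Matrix.diagonal (fun i => ((√(hM.isHermitian.eigenvalues i) ^ (2 * p) : ℝ) : ℂ)) *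
          (hM.isHermitian.eigenvectorUnitary : Matrix k k ℂ)ᴴ *
            ptrace2 (mrpow Y p)).trace.re := by
    rw [hσ.isHermitian.eq_conj_diagonal, re_trace_conj_diagonal_mul]
    exact Finset.sum_nonneg fun i _ => Finset.sum_nonneg fun j _ =>
      mul_nonneg (mul_nonneg (Real.rpow_nonneg (Real.sqrt_nonneg _) _) (sq_nonneg _))
        (hσ.eigenvalues_nonneg j)
  refine (Real.rpow_le_rpow (mul_nonneg (hnonneg hAA) (hnonneg hBB))
    (mul_le_mul hA hB (hnonneg hBB) (by positivity)) (by positivity)).trans_eq ?_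
  rw [Psi_eq hσ.isHermitian]
  set T := ∑ i, hσ.isHermitian.eigenvalues i ^ (q / p)
  have e1 : schattenNorm R A ^ (2 * p) * T ^ (p / q) *
      (schattenNorm R B ^ (2 * p) * T ^ (p / q)) =
        (T ^ (1 / q) * (schattenNorm R A * schattenNorm R B)) ^ (2 * p) := by
    rw [Real.mul_rpow (by positivity) (by positivity), Real.mul_rpow hA0 hB0,
      ← Real.rpow_mul hs0, show 1 / q * (2 * p) = p / q + p / q by ring,
      Real.rpow_add_of_nonneg hs0 (by positivity) (by positivity)]
    ring
  rw [e1, ← Real.rpow_mul (by positivity), mul_one_div_cancel (by positivity), Real.rpow_one]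

theorem ncNormInf_le_Psi {p q : ℝ} (hq : 1 ≤ q) (hqp : q < p) {Y : Matrix (k × l) (k × l) ℂ}
    (hY : Y.PosSemidef) :
    ncNormInf (ENNReal.ofReal p) (ENNReal.ofReal q) Y ≤ Psi p q Y := by
  have hq0 : 0 < q := by linarith
  have hp0 : 0 < p := by linarith
  have hd : 0 < p - q := sub_pos.2 hqp
  have hσ := posSemidef_ptrace2 (posSemidef_mrpow hY p)
  have hSu := hσ.isHermitian.eigenvectorUnitary.2
  have hσS := hσ.isHermitian.eq_conj_diagonal
  rw [Psi_eq hσ.isHermitian]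
  have hs0 : ∀ i, 0 ≤ hσ.isHermitian.eigenvalues i := hσ.eigenvalues_nonneg
  generalize hσ.isHermitian.eigenvalues = s at *
  generalize (hσ.isHermitian.eigenvectorUnitary : Matrix k k ℂ) = S at *
  have hSS : Sᴴ * S = 1 := Matrix.mem_unitaryGroup_iff'.1 hSu
  have hSS' : S * Sᴴ = 1 := Matrix.mem_unitaryGroup_iff.1 hSu
  have hbound : ∀ ε : ℝ, 0 < ε → ncNormInf (ENNReal.ofReal p) (ENNReal.ofReal q) Y ≤
      (∑ i, (s i + ε) ^ (q / p)) ^ (1 / q) := by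
    intro ε hε
    have hsε (i : k) : 0 < s i + ε := add_pos_of_nonneg_of_pos (hs0 i) hε
    let M (c : ℝ) : Matrix k k ℂ :=
      S * Matrix.diagonal (fun i => (((s i + ε) ^ c : ℝ) : ℂ)) * Sᴴ
    have hMmul (c d : ℝ) : M c * M d = M (c + d) := by
      simp only [M]
      rw [show ∀ D D' : Matrix k k ℂ, S * D * Sᴴ * (S * D' * Sᴴ) = S * D * (Sᴴ * S) * D' * Sᴴ by
        intros; simp only [Matrix.mul_assoc], hSS, Matrix.mul_one, Matrix.mul_assoc S,
        Matrix.diagonal_mul_diagonal]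
      simp only [← Complex.ofReal_mul, Real.rpow_add (hsε _)]
    have hMstar (c : ℝ) : (M c)ᴴ = M c := by
      simp only [M, Matrix.conjTranspose_mul, Matrix.conjTranspose_conjTranspose,
        Matrix.diagonal_conjTranspose, Matrix.mul_assoc]
      congr 3
      funext i
      simp
    have hMzero : M 0 = 1 := by simp [M, hSS']
    have hMsq (c : ℝ) : M c * M c =
        S * Matrix.diagonal (fun i => ((((s i + ε) ^ c) ^ 2 : ℝ) : ℂ)) * Sᴴ := by
      rw [hMmul]
      simp only [M, Real.rpow_add (hsε _), sq]
    let t := (p - q) / (2 * p ^ 2)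
    let Z := (M (-t) ⊗ₖ (1 : Matrix l l ℂ)) * Y * (M (-t) ⊗ₖ (1 : Matrix l l ℂ))
    have hZ : Y = (M t ⊗ₖ (1 : Matrix l l ℂ)) * Z * (M t ⊗ₖ (1 : Matrix l l ℂ)) := by
      have h1 : (M t ⊗ₖ (1 : Matrix l l ℂ)) * (M (-t) ⊗ₖ (1 : Matrix l l ℂ)) = 1 := by
        rw [← Matrix.mul_kronecker_mul, hMmul, add_neg_cancel, hMzero, Matrix.mul_one,
          Matrix.one_kronecker_one]
      have h2 : (M (-t) ⊗ₖ (1 : Matrix l l ℂ)) * (M t ⊗ₖ (1 : Matrix l l ℂ)) = 1 := by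
        rw [← Matrix.mul_kronecker_mul, hMmul, neg_add_cancel, hMzero, Matrix.mul_one,
          Matrix.one_kronecker_one]
      simp only [Z, Matrix.mul_assoc, h2, Matrix.mul_one]
      rw [← Matrix.mul_assoc, h1, Matrix.one_mul]
    have hT0 : 0 ≤ ∑ i, (s i + ε) ^ (q / p) :=
      Finset.sum_nonneg fun i _ => Real.rpow_nonneg (hsε i).le _
    have hZle : schattenNorm (ENNReal.ofReal p) Z ≤ (∑ i, (s i + ε) ^ (q / p)) ^ (1 / p) := by
      refine (schattenNorm_kronecker_mul_mul_le (hq.trans hqp.le) hY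
        (fun i => Real.rpow_nonneg (hsε i).le (-t)) (fun i => Real.rpow_nonneg (hsε i).le (-t))
        hSu hSu (by rw [hMstar, hMsq]) (by rw [hMstar, hMsq])).trans ?_
      rw [hσS, re_trace_conj_diagonal_mul, hSS, ← sq]
      have h1 : ∑ i, ∑ j, ((s i + ε) ^ (-t)) ^ (2 * p) * ‖(1 : Matrix k k ℂ) i j‖ ^ 2 * s j =
          ∑ i, ((s i + ε) ^ (-t)) ^ (2 * p) * s i := by
        refine Finset.sum_congr rfl fun i _ => ?_
        rw [Finset.sum_eq_single i] <;> simp +contextual [eq_comm]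
      have h2 : 0 ≤ ∑ i, ((s i + ε) ^ (-t)) ^ (2 * p) * s i :=
        Finset.sum_nonneg fun i _ => mul_nonneg
          (Real.rpow_nonneg (Real.rpow_nonneg (hsε i).le _) _) (hs0 i)
      rw [h1, ← Real.rpow_natCast, ← Real.rpow_mul h2,
        show ((2 : ℕ) : ℝ) * (1 / (2 * p)) = 1 / p by push_cast; field_simp]
      refine Real.rpow_le_rpow h2 (Finset.sum_le_sum fun i _ => ?_) (by positivity)
      calc ((s i + ε) ^ (-t)) ^ (2 * p) * s i ≤ ((s i + ε) ^ (-t)) ^ (2 * p) * (s i + ε) :=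
            mul_le_mul_of_nonneg_left (by linarith)
              (Real.rpow_nonneg (Real.rpow_nonneg (hsε i).le _) _)
        _ = (s i + ε) ^ (q / p) := by
            rw [← Real.rpow_mul (hsε i).le, ← Real.rpow_add_one (hsε i).ne']
            congr 1
            simp only [t]
            field_simp
            ring
    have hM : schattenNorm (2 * ncR (ENNReal.ofReal p) (ENNReal.ofReal q)) (M t) =
        (∑ i, (s i + ε) ^ (q / p)) ^ ((p - q) / (2 * q * p)) := by
      rw [ncR_comm, two_mul_ncR_ofReal hq0 hqp, schattenNorm_of_conjTranspose_mul_self_eq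
        ENNReal.ofReal_ne_top hSu (d := fun i => ((s i + ε) ^ t) ^ 2) (by rw [hMstar, hMsq]),
        ENNReal.toReal_ofReal (by positivity), one_div_div]
      congr 1
      refine Finset.sum_congr rfl fun i _ => ?_
      rw [← Real.rpow_natCast, ← Real.rpow_mul (hsε i).le, ← Real.rpow_mul (hsε i).le]
      congr 1
      simp only [t]
      push_cast
      field_simp
    have hα : 0 ≤ (p - q) / (2 * q * p) := div_nonneg hd.le (by positivity)
    rw [ncNormInf]
    refine le_trans (csInf_le ⟨0, ?_⟩ ⟨1, fun _ => M t, fun _ => M t, fun _ => Z,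
      by simpa using hZ, rfl⟩) ?_
    · rintro _ ⟨N, A, B, Z, -, rfl⟩
      exact Finset.sum_nonneg fun i _ => mul_nonneg (mul_nonneg (schattenNorm_nonneg _ _)
        (schattenNorm_nonneg _ _)) (schattenNorm_nonneg _ _)
    · rw [Fin.sum_univ_one, hM, ← Real.rpow_add_of_nonneg hT0 hα hα]
      refine (mul_le_mul_of_nonneg_left hZle (Real.rpow_nonneg hT0 _)).trans_eq ?_
      rw [← Real.rpow_add_of_nonneg hT0 (add_nonneg hα hα) (by positivity)]
      congr 1
      field_simp
      ring
  have hlim : Filter.Tendsto (fun ε : ℝ => (∑ i, (s i + ε) ^ (q / p)) ^ (1 / q))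
      (nhdsWithin 0 (Set.Ioi 0)) (nhds ((∑ i, s i ^ (q / p)) ^ (1 / q))) := by
    have hc : Continuous fun ε : ℝ => (∑ i, (s i + ε) ^ (q / p)) ^ (1 / q) := by
      refine Continuous.rpow_const (continuous_finsetSum _ fun i _ => ?_)
        fun _ => Or.inr (by positivity)
      exact Continuous.rpow_const (by fun_prop) fun _ => Or.inr (by positivity)
    simpa using (hc.tendsto 0).mono_left nhdsWithin_le_nhds
  exact ge_of_tendsto hlim (Filter.eventually_of_mem self_mem_nhdsWithin fun ε hε => hbound ε hε)

end NCNorm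

/-- **The NC norm is bounded above by `Ψ_{p,q}` on positive semidefinite matrices**
(`1 ≤ p ≤ 2`, `q ≥ 1`). -/
theorem ncNorm_le_psi {n m : ℕ} (hn : 0 < n) (hm : 0 < m) (p q : ℝ)
    (hp1 : 1 ≤ p) (hp2 : p ≤ 2) (hq : 1 ≤ q)
    (Y : Matrix (Fin n × Fin m) (Fin n × Fin m) ℂ) (hY : Y.PosSemidef) :
    ncNorm (ENNReal.ofReal p) (ENNReal.ofReal q) Y ≤ Psi p q Y := by
  rw [ncNorm]
  split_ifs with h
  · exact ncNormSup_le_Psi hp1 ((ENNReal.ofReal_le_ofReal_iff (by linarith)).1 h) hY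
  · exact ncNormInf_le_Psi hq (lt_of_not_ge fun h' => h (ENNReal.ofReal_le_ofReal h')) hY
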